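/- Let 0 < α < 1, β ≥ 0, λ ∈ ℝ and h ∈ ℝ, and define y(t) = (h/Γ(α+1)) t^α E_{α, 1+β/α, 1+β/α}(λ t^{α+β}) for t > 0, with y(0) = 0. Then y satisfies the Riemann–Liouville fractional differential equation ({}_{RL}D^α_{0t} y)(t) = λ t^β y(t) + h for all t > 0, and lim_{t→0⁺} (I^{1−α}_{0t} y)(t) = 0. -/

import Mathlib

open MeasureTheory
open scoped BigOperators

/-- The real Kilbas generalized Mittag-Leffler function
`E_{α,m,n}(x) = 1 + Σ_{k≥1} (∏_{j=0}^{k-1} Γ(α(jm+n)+1)/Γ(α(jm+n+1)+1)) x^k`. -/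
noncomputable def kilbasML (α m n : ℝ) (x : ℝ) : ℝ :=
  ∑' k : ℕ, (∏ j ∈ Finset.range k,
      Real.Gamma (α * ((j : ℝ) * m + n) + 1) /
        Real.Gamma (α * ((j : ℝ) * m + n + 1) + 1)) * x ^ k

/-- Gautschi-type bound for the quotient of two values of `Γ`. -/
lemma Gamma_div_Gamma_add_le {x a : ℝ} (ha0 : 0 < a) (ha1 : a < 1) (hx : 0 < x + a - 1) :
    Real.Gamma x / Real.Gamma (x + a) ≤ (x + a - 1) ^ (-a) := by
  have hG : 0 < Real.Gamma (x + a) := Real.Gamma_pos_of_pos (by linarith)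
  have hconv := Real.Gamma_mul_add_mul_le_rpow_Gamma_mul_rpow_Gamma (s := x + a) (t := x + a - 1)
    (a := 1 - a) (b := a) (by linarith) hx (by linarith) ha0 (by ring)
  have harg : (1 - a) * (x + a) + a * (x + a - 1) = x := by ring
  have hstep : Real.Gamma (x + a) = (x + a - 1) * Real.Gamma (x + a - 1) := by
    have := Real.Gamma_add_one hx.ne'
    rwa [sub_add_cancel] at this
  have hprev : Real.Gamma (x + a - 1) = Real.Gamma (x + a) * (x + a - 1)⁻¹ := by
    rw [hstep]; field_simp
  rw [harg, hprev, Real.mul_rpow hG.le (inv_nonneg.2 hx.le), ← mul_assoc, ← Real.rpow_add hG,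
    sub_add_cancel, Real.rpow_one, Real.inv_rpow hx.le, ← Real.rpow_neg hx.le] at hconv
  rw [div_le_iff₀ hG]
  linarith

/-- The coefficients of the power series `kilbasML α m n`. -/
noncomputable def kilbasCoeff (α m n : ℝ) (k : ℕ) : ℝ :=
  ∏ j ∈ Finset.range k, Real.Gamma (α * ((j : ℝ) * m + n) + 1) /
    Real.Gamma (α * ((j : ℝ) * m + n + 1) + 1)

lemma kilbasCoeff_succ (α m n : ℝ) (k : ℕ) :
    kilbasCoeff α m n (k + 1) = kilbasCoeff α m n k *
      (Real.Gamma (α * ((k : ℝ) * m + n) + 1) / Real.Gamma (α * ((k : ℝ) * m + n + 1) + 1)) :=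
  Finset.prod_range_succ _ _

lemma kilbasCoeff_pos {α m n : ℝ} (hα : 0 < α) (hm : 0 < m) (hn : 0 ≤ n) (k : ℕ) :
    0 < kilbasCoeff α m n k :=
  Finset.prod_pos fun _ _ => div_pos (Real.Gamma_pos_of_pos (by positivity))
    (Real.Gamma_pos_of_pos (by positivity))

lemma summable_kilbasCoeff_mul_pow {α m n : ℝ} (hα0 : 0 < α) (hα1 : α < 1) (hm : 0 < m)
    (hn : 0 ≤ n) (x : ℝ) : Summable fun k => kilbasCoeff α m n k * x ^ k := by
  rcases eq_or_ne x 0 with rfl | hx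
  · refine summable_of_ne_finset_zero (s := {0}) fun k hk => ?_
    have : k ≠ 0 := by simpa using hk
    simp [this]
  have hpos := kilbasCoeff_pos hα0 hm hn
  refine summable_of_ratio_test_tendsto_lt_one (l := 0) one_pos
    (Filter.Eventually.of_forall fun k => mul_ne_zero (hpos k).ne' (pow_ne_zero _ hx)) ?_
  have hlim : Filter.Tendsto (fun k : ℕ => (α * ((k : ℝ) * m + n) + α) ^ (-α) * |x|)
      Filter.atTop (nhds 0) := by
    have hlin : Filter.Tendsto (fun k : ℕ => α * ((k : ℝ) * m + n) + α)
        Filter.atTop Filter.atTop :=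
      Filter.tendsto_atTop_add_const_right _ _ (Filter.Tendsto.const_mul_atTop hα0
        (Filter.tendsto_atTop_add_const_right _ _
          (tendsto_natCast_atTop_atTop.atTop_mul_const hm)))
    simpa using ((tendsto_rpow_neg_atTop hα0).comp hlin).mul_const |x|
  refine squeeze_zero (fun k => by positivity) (fun k => ?_) hlim
  have hk : 0 < α * ((k : ℝ) * m + n) + α := by positivity
  have hle := Gamma_div_Gamma_add_le (x := α * ((k : ℝ) * m + n) + 1) hα0 hα1 (by linarith)
  rw [show α * ((k : ℝ) * m + n) + 1 + α = α * ((k : ℝ) * m + n + 1) + 1 by ring,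
    show α * ((k : ℝ) * m + n + 1) + 1 - 1 = α * ((k : ℝ) * m + n) + α by ring] at hle
  have hratio : 0 < Real.Gamma (α * ((k : ℝ) * m + n) + 1) /
      Real.Gamma (α * ((k : ℝ) * m + n + 1) + 1) :=
    div_pos (Real.Gamma_pos_of_pos (by positivity)) (Real.Gamma_pos_of_pos (by positivity))
  rw [kilbasCoeff_succ, norm_mul, norm_mul, norm_mul, norm_pow, norm_pow,
    Real.norm_of_nonneg (hpos k).le, Real.norm_of_nonneg hratio.le, Real.norm_eq_abs, pow_succ]
  have hxk : 0 < |x| := abs_pos.2 hx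
  calc _ = Real.Gamma (α * ((k : ℝ) * m + n) + 1) /
        Real.Gamma (α * ((k : ℝ) * m + n + 1) + 1) * |x| := by
        have := (hpos k).ne'
        field_simp
    _ ≤ _ := by gcongr

/-- The Riemann–Liouville integral of a power function, up to the factor `1 / Γ(γ)`. -/
lemma integral_sub_rpow_mul_rpow {γ p τ : ℝ} (hγ : 0 < γ) (hp : -1 < p) (hτ : 0 < τ) :
    ∫ s in Set.Ioo 0 τ, (τ - s) ^ (γ - 1) * s ^ p =
      Real.Gamma γ * Real.Gamma (p + 1) / Real.Gamma (γ + p + 1) * τ ^ (γ + p) := by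
  have hscaled := Complex.betaIntegral_scaled ((p + 1 : ℝ) : ℂ) (γ : ℂ) hτ
  rw [Complex.betaIntegral_eq_Gamma_mul_div _ _ (by simpa using by linarith) (by simpa using hγ),
    intervalIntegral.integral_of_le hτ.le, integral_Ioc_eq_integral_Ioo] at hscaled
  apply Complex.ofReal_injective
  rw [← integral_complex_ofReal]
  refine Eq.trans (setIntegral_congr_fun measurableSet_Ioo fun s hs => ?_) (hscaled.trans ?_)
  · have hs0 : 0 ≤ s := hs.1.le
    have hs1 : 0 ≤ τ - s := by linarith [hs.2]
    simp only [Complex.ofReal_mul]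
    rw [Complex.ofReal_cpow hs0, Complex.ofReal_cpow hs1, mul_comm]
    push_cast
    simp
  · rw [← Complex.ofReal_add, Complex.Gamma_ofReal, Complex.Gamma_ofReal, Complex.Gamma_ofReal,
      show p + 1 + γ = γ + p + 1 by ring]
    push_cast
    rw [Complex.ofReal_cpow hτ.le, show ((γ : ℂ) + p + 1 - 1) = ((γ + p : ℝ) : ℂ) by
      push_cast; ring]
    ring

lemma integrableOn_sub_rpow_mul_rpow {γ p τ : ℝ} (hγ : 0 < γ) (hp : -1 < p) (hτ : 0 < τ) :
    IntegrableOn (fun s => (τ - s) ^ (γ - 1) * s ^ p) (Set.Ioo 0 τ) := by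
  refine not_imp_comm.1 integral_undef ?_
  rw [integral_sub_rpow_mul_rpow hγ hp hτ]
  have h₁ := Real.Gamma_pos_of_pos hγ
  have h₂ := Real.Gamma_pos_of_pos (show 0 < p + 1 by linarith)
  have h₃ := Real.Gamma_pos_of_pos (show 0 < γ + p + 1 by linarith)
  positivity

/-- Termwise fractional integration of a series of power functions. -/
lemma integral_sub_rpow_mul_tsum {γ τ : ℝ} (hγ : 0 < γ) (hτ : 0 < τ) {b p : ℕ → ℝ}
    (hp : ∀ k, -1 < p k)
    (hs : Summable fun k => |b k| *
      (Real.Gamma γ * Real.Gamma (p k + 1) / Real.Gamma (γ + p k + 1) * τ ^ (γ + p k))) :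
    ∫ s in Set.Ioo 0 τ, (τ - s) ^ (γ - 1) * ∑' k, b k * s ^ p k =
      ∑' k, b k *
        (Real.Gamma γ * Real.Gamma (p k + 1) / Real.Gamma (γ + p k + 1) * τ ^ (γ + p k)) := by
  have key := hasSum_integral_of_summable_integral_norm
    (μ := volume.restrict (Set.Ioo 0 τ))
    (F := fun k s => b k * ((τ - s) ^ (γ - 1) * s ^ p k))
    (fun k => (integrableOn_sub_rpow_mul_rpow hγ (hp k) hτ).const_mul _) ?_
  · simp only [integral_const_mul, integral_sub_rpow_mul_rpow hγ (hp _) hτ] at key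
    rw [key.tsum_eq]
    refine setIntegral_congr_fun measurableSet_Ioo fun s _ => ?_
    simp only [← tsum_mul_left]
    exact tsum_congr fun k => mul_left_comm _ _ _
  · refine hs.congr fun k => ?_
    rw [← integral_sub_rpow_mul_rpow hγ (hp k) hτ, ← integral_const_mul]
    refine setIntegral_congr_fun measurableSet_Ioo fun s hs => ?_
    have h₁ : 0 ≤ (τ - s) ^ (γ - 1) := Real.rpow_nonneg (by linarith [hs.2]) _
    have h₂ : 0 ≤ s ^ p k := Real.rpow_nonneg hs.1.le _
    simp only [norm_mul, Real.norm_of_nonneg h₁, Real.norm_of_nonneg h₂, Real.norm_eq_abs]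

lemma rpow_natCast_mul {t : ℝ} (ht : 0 ≤ t) (δ : ℝ) (k : ℕ) :
    t ^ ((k : ℝ) * δ) = (t ^ δ) ^ k := by
  rw [mul_comm, Real.rpow_mul ht, Real.rpow_natCast]

/-- Termwise differentiation of a series in the powers `τ ^ (k δ + 1)`. -/
lemma hasDerivAt_tsum_rpow {δ t : ℝ} (hδ : 0 < δ) (ht : 0 < t) {a : ℕ → ℝ}
    (ha : ∀ x, Summable fun k => a k * x ^ k) :
    HasDerivAt (fun τ => ∑' k : ℕ, a k * (τ ^ ((k : ℝ) * δ + 1) / ((k : ℝ) * δ + 1)))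
      (∑' k : ℕ, a k * t ^ ((k : ℝ) * δ)) t := by
  have hu : Summable fun k => |a k| * ((t + 1) ^ δ) ^ k := by
    refine (ha ((t + 1) ^ δ)).abs.congr fun k => ?_
    rw [abs_mul, abs_of_nonneg (a := ((t + 1) ^ δ) ^ k) (by positivity)]
  refine hasDerivAt_tsum_of_isPreconnected hu (t := Set.Ioo 0 (t + 1)) (y₀ := t)
    (g := fun (k : ℕ) τ => a k * (τ ^ ((k : ℝ) * δ + 1) / ((k : ℝ) * δ + 1)))
    (g' := fun (k : ℕ) τ => a k * τ ^ ((k : ℝ) * δ))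
    isOpen_Ioo isPreconnected_Ioo (fun k τ hτ => ?_) (fun k τ hτ => ?_) ⟨ht, by linarith⟩ ?_
    ⟨ht, by linarith⟩
  · have hk : (k : ℝ) * δ + 1 ≠ 0 := by positivity
    have := ((Real.hasDerivAt_rpow_const (p := (k : ℝ) * δ + 1)
      (Or.inl hτ.1.ne')).div_const ((k : ℝ) * δ + 1)).const_mul (a k)
    rwa [add_sub_cancel_right, mul_div_cancel_left₀ _ hk] at this
  · have h0 : 0 ≤ τ := hτ.1.le
    rw [norm_mul, Real.norm_eq_abs, rpow_natCast_mul h0,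
      Real.norm_of_nonneg (by positivity)]
    have h1 : τ ≤ t + 1 := hτ.2.le
    gcongr
  · refine Summable.of_norm_bounded (hu.mul_right (t + 1)) fun k => ?_
    have hk : 0 ≤ (k : ℝ) * δ := by positivity
    rw [norm_mul, Real.norm_eq_abs, Real.norm_of_nonneg (by positivity),
      Real.rpow_add_one ht.ne', rpow_natCast_mul ht.le, mul_assoc]
    gcongr
    refine (div_le_self (by positivity) (by linarith)).trans ?_
    gcongr <;> linarith

lemma tendsto_tsum_rpow_zero {δ : ℝ} (hδ : 0 < δ) {a : ℕ → ℝ}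
    (ha : ∀ x, Summable fun k => a k * x ^ k) :
    Filter.Tendsto
      (fun τ => ∑' k : ℕ, a k * (τ ^ ((k : ℝ) * δ + 1) / ((k : ℝ) * δ + 1)))
      (nhdsWithin 0 (Set.Ioi 0)) (nhds 0) := by
  have hu : Summable fun k => |a k| := (ha 1).abs.congr fun k => by simp
  have hlim : Filter.Tendsto (fun τ : ℝ => (∑' k, |a k|) * τ)
      (nhdsWithin 0 (Set.Ioi 0)) (nhds 0) :=
    tendsto_nhdsWithin_of_tendsto_nhds (Continuous.tendsto' (by fun_prop) _ _ (by simp))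
  refine squeeze_zero_norm' ?_ hlim
  filter_upwards [Ioo_mem_nhdsGT (zero_lt_one' ℝ)] with τ hτ
  have hτ0 : 0 < τ := hτ.1
  refine tsum_of_norm_bounded (hu.hasSum.mul_right τ) fun k => ?_
  have hk : 0 ≤ (k : ℝ) * δ := by positivity
  rw [norm_mul, Real.norm_eq_abs, Real.norm_of_nonneg (by positivity), Real.rpow_add_one hτ0.ne']
  gcongr
  refine (div_le_self (by positivity) (by linarith)).trans ?_
  exact mul_le_of_le_one_left hτ0.le (Real.rpow_le_one hτ0.le hτ.2.le hk)

theorem riemann_liouville_solution (α β lam h : ℝ)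
    (hα0 : 0 < α) (hα1 : α < 1) (hβ : 0 ≤ β) :
    let y : ℝ → ℝ := fun t =>
      (h / Real.Gamma (α + 1)) * t ^ α *
        kilbasML α (1 + β / α) (1 + β / α) (lam * t ^ (α + β))
    -- the Riemann–Liouville derivative (d/dt) I^{1−α} y exists and satisfies the equation
    (∀ t : ℝ, 0 < t →
        HasDerivAt (fun τ : ℝ => (1 / Real.Gamma (1 - α)) *
            ∫ s in Set.Ioo 0 τ, (τ - s) ^ ((1 - α) - 1) * y s)
          (lam * t ^ β * y t + h) t) ∧
    y 0 = 0 ∧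
    -- lim_{t→0⁺} (I^{1−α} y)(t) = 0
    Filter.Tendsto (fun t : ℝ => (1 / Real.Gamma (1 - α)) *
        ∫ s in Set.Ioo 0 t, (t - s) ^ ((1 - α) - 1) * y s)
      (nhdsWithin 0 (Set.Ioi 0)) (nhds 0) := by
  intro y
  set δ := α + β with hδ_def
  set m := 1 + β / α with hm_def
  have hδ : 0 < δ := by positivity
  have hm : 0 < m := by positivity
  have hαm : α * m = δ := by rw [hm_def, hδ_def]; field_simp
  have hΓα : 0 < Real.Gamma (α + 1) := Real.Gamma_pos_of_pos (by linarith)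
  have hΓ1α : 0 < Real.Gamma (1 - α) := Real.Gamma_pos_of_pos (by linarith)
  set C := h / Real.Gamma (α + 1) with hC_def
  set c := kilbasCoeff α m m with hc_def
  have hcsucc : ∀ k : ℕ, c (k + 1) = c k *
      (Real.Gamma (((k + 1 : ℕ) : ℝ) * δ + 1) /
        Real.Gamma (((k + 1 : ℕ) : ℝ) * δ + α + 1)) := by
    intro k
    rw [hc_def, kilbasCoeff_succ, ← hαm]
    push_cast
    ring_nf
  let d : ℕ → ℝ := fun k =>
    c k * Real.Gamma ((k : ℝ) * δ + α + 1) / Real.Gamma ((k : ℝ) * δ + 1)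
  have hd0 : d 0 = Real.Gamma (α + 1) := by simp [d, hc_def, kilbasCoeff]
  have hdsucc : ∀ k, d (k + 1) = c k := by
    intro k
    have h₁ : 0 < Real.Gamma (((k + 1 : ℕ) : ℝ) * δ + 1) := Real.Gamma_pos_of_pos (by positivity)
    have h₂ : 0 < Real.Gamma (((k + 1 : ℕ) : ℝ) * δ + α + 1) :=
      Real.Gamma_pos_of_pos (by positivity)
    simp only [d]
    rw [hcsucc]
    field_simp
  have hcsum : ∀ x : ℝ, Summable fun k => c k * x ^ k :=
    summable_kilbasCoeff_mul_pow hα0 hα1 hm hm.le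
  let a : ℕ → ℝ := fun k => C * (d k * lam ^ k)
  have hasum : ∀ x : ℝ, Summable fun k => a k * x ^ k := by
    intro x
    rw [← summable_nat_add_iff 1]
    refine ((hcsum (lam * x)).mul_left (C * lam * x)).congr fun k => ?_
    simp only [a]
    rw [hdsucc]
    ring
  have hy : ∀ s, 0 < s → y s = ∑' k : ℕ, C * (c k * lam ^ k) * s ^ ((k : ℝ) * δ + α) := by
    intro s hs
    change C * s ^ α * ∑' k, c k * (lam * s ^ δ) ^ k = _
    rw [← tsum_mul_left]
    refine tsum_congr fun k => ?_
    rw [Real.rpow_add hs ((k : ℝ) * δ), rpow_natCast_mul hs.le, mul_pow]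
    ring
  have hcoeff : ∀ (k : ℕ) (τ : ℝ), C * (c k * lam ^ k) * (Real.Gamma (1 - α) *
      Real.Gamma ((k : ℝ) * δ + α + 1) / Real.Gamma ((1 - α) + ((k : ℝ) * δ + α) + 1) *
        τ ^ ((1 - α) + ((k : ℝ) * δ + α))) =
      Real.Gamma (1 - α) * (a k * (τ ^ ((k : ℝ) * δ + 1) / ((k : ℝ) * δ + 1))) := by
    intro k τ
    have hk : 0 < (k : ℝ) * δ + 1 := by positivity
    have h₁ := Real.Gamma_pos_of_pos hk
    rw [show (1 - α) + ((k : ℝ) * δ + α) = (k : ℝ) * δ + 1 by ring,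
      Real.Gamma_add_one hk.ne']
    simp only [a, d]
    field_simp
  have hI : ∀ τ, 0 < τ → (1 / Real.Gamma (1 - α)) *
      ∫ s in Set.Ioo 0 τ, (τ - s) ^ ((1 - α) - 1) * y s =
        ∑' k : ℕ, a k * (τ ^ ((k : ℝ) * δ + 1) / ((k : ℝ) * δ + 1)) := by
    intro τ hτ
    have hyint : ∫ s in Set.Ioo 0 τ, (τ - s) ^ ((1 - α) - 1) * y s =
        ∫ s in Set.Ioo 0 τ, (τ - s) ^ ((1 - α) - 1) *
          ∑' k : ℕ, C * (c k * lam ^ k) * s ^ ((k : ℝ) * δ + α) :=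
      setIntegral_congr_fun measurableSet_Ioo fun s hs => by simp only [hy s hs.1]
    rw [hyint, integral_sub_rpow_mul_tsum (by linarith) hτ
      (b := fun k => C * (c k * lam ^ k)) (p := fun k => (k : ℝ) * δ + α)]
    · simp only [hcoeff]
      rw [tsum_mul_left, ← mul_assoc, one_div_mul_cancel hΓ1α.ne', one_mul]
    · intro k
      have : 0 ≤ (k : ℝ) * δ := by positivity
      linarith
    · refine Summable.of_norm_bounded
        (((hasum (τ ^ δ)).abs.mul_right τ).mul_left (Real.Gamma (1 - α))) fun k => ?_
      have hk : 0 ≤ (k : ℝ) * δ := by positivity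
      rw [norm_mul, Real.norm_eq_abs, Real.norm_eq_abs, abs_abs, ← abs_mul, hcoeff, abs_mul,
        abs_of_pos hΓ1α, abs_mul (a k), abs_mul (a k), Real.rpow_add_one hτ.ne',
        rpow_natCast_mul hτ.le, abs_of_nonneg (a := (τ ^ δ) ^ k) (by positivity),
        abs_of_nonneg (a := _ / _) (by positivity), mul_assoc]
      gcongr
      exact div_le_self (by positivity) (by linarith)
  refine ⟨fun t ht => ?_, ?_, ?_⟩
  · have hval : ∑' k : ℕ, a k * t ^ ((k : ℝ) * δ) = lam * t ^ β * y t + h := by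
      simp only [rpow_natCast_mul ht.le]
      rw [(hasum (t ^ δ)).tsum_eq_zero_add, hy t ht, ← tsum_mul_left, add_comm]
      congr 1
      · refine tsum_congr fun k => ?_
        simp only [a]
        rw [hdsucc, Real.rpow_add ht ((k : ℝ) * δ), rpow_natCast_mul ht.le, pow_succ, pow_succ,
          show t ^ δ = t ^ α * t ^ β from Real.rpow_add ht _ _]
        ring
      · simp only [a, hd0, hC_def]
        field_simp
    rw [← hval]
    refine (hasDerivAt_tsum_rpow hδ ht hasum).congr_of_eventuallyEq ?_
    filter_upwards [Ioi_mem_nhds ht] with τ hτ using hI τ hτ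
  · simp [y, Real.zero_rpow hα0.ne']
  · refine (tendsto_tsum_rpow_zero hδ hasum).congr' ?_
    filter_upwards [self_mem_nhdsWithin] with τ hτ using (hI τ hτ).symm
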